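/- (Interaction Morawetz identity for factorized solutions / cubic NLS.) Let φ = φ(t,x) : ℝ × ℝᵈ → ℂ be smooth, Schwartz class in x locally uniformly in t, solving the cubic nonlinear Schrödinger equation i∂ₜφ + Δφ = λ|φ|²φ, and set P_φ(t,x) = Im(φ̄ ∇φ)(t,x). Let a : ℝᵈ × ℝᵈ → ℝ be smooth with all derivatives of at most polynomial growth, and define M_a(t) = ∫∫ |φ(t,y)|² ∇_x a(x,y) · P_φ(t,x) dx dy. Then for every t, d/dt M_a(t) = −(1/2) ∫∫ |φ(t,y)|² (Δ_x a(x,y)) Δ_x(|φ(t,x)|²) dx dy + (λ/2) ∫∫ (Δ_x a(x,y)) |φ(t,y)|² |φ(t,x)|⁴ dx dy + 2 Re ∫∫ |φ(t,y)|² Σ_{j,ℓ} (∂_{x_j}∂_{x_ℓ} a(x,y)) (∂_{x_ℓ}φ(t,x)) (conjugate of ∂_{x_j}φ(t,x)) dx dy + 2 ∫∫ Σ_{j,ℓ} (∂_{x_j}∂_{y_ℓ} a(x,y)) (P_φ(t,x))_j (P_φ(t,y))_ℓ dx dy. -/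

import Mathlib

open MeasureTheory Complex

noncomputable section

/-- Euclidean space `ℝᵈ`. -/
abbrev Ed (d : ℕ) := EuclideanSpace ℝ (Fin d)

/-- Partial derivative `∂_{x_j} f` of a complex-valued function on `ℝᵈ`. -/
noncomputable def pd {d : ℕ} (j : Fin d) (f : Ed d → ℂ) (x : Ed d) : ℂ :=
  fderiv ℝ f x (EuclideanSpace.single j 1)

/-- Laplacian of a complex-valued function on `ℝᵈ`. -/
noncomputable def lap {d : ℕ} (f : Ed d → ℂ) (x : Ed d) : ℂ := ∑ j, pd j (pd j f) x

/-- Partial derivative `∂_{x_j} f` of a real-valued function on `ℝᵈ`. -/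
noncomputable def rpd {d : ℕ} (j : Fin d) (f : Ed d → ℝ) (x : Ed d) : ℝ :=
  fderiv ℝ f x (EuclideanSpace.single j 1)

/-- Laplacian of a real-valued function on `ℝᵈ`. -/
noncomputable def rlap {d : ℕ} (f : Ed d → ℝ) (x : Ed d) : ℝ := ∑ j, rpd j (rpd j f) x

/-- Partial derivative `∂_{x_j}` (first factor) of a real function on `ℝᵈ × ℝᵈ`. -/
noncomputable def pdx {d : ℕ} (j : Fin d) (f : Ed d × Ed d → ℝ) (q : Ed d × Ed d) : ℝ :=
  fderiv ℝ f q (EuclideanSpace.single j 1, 0)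

/-- Partial derivative `∂_{y_ℓ}` (second factor) of a real function on `ℝᵈ × ℝᵈ`. -/
noncomputable def pdy {d : ℕ} (ℓ : Fin d) (f : Ed d × Ed d → ℝ) (q : Ed d × Ed d) : ℝ :=
  fderiv ℝ f q (0, EuclideanSpace.single ℓ 1)

/-- Laplacian `Δ_x` in the first factor of a real function on `ℝᵈ × ℝᵈ`. -/
noncomputable def lapX {d : ℕ} (f : Ed d × Ed d → ℝ) (q : Ed d × Ed d) : ℝ :=
  ∑ j, pdx j (pdx j f) q

/-- `φ` is a smooth solution of the cubic NLS `i∂ₜφ + Δφ = λ|φ|²φ`,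
Schwartz class in `x` locally uniformly in `t`. -/
structure CubicNLSSolution (d : ℕ) (lam : ℝ) (φ : ℝ → Ed d → ℂ) : Prop where
  smooth : ContDiff ℝ (⊤ : ℕ∞) (fun q : ℝ × Ed d => φ q.1 q.2)
  decay : ∀ (k N : ℕ) (T : ℝ), ∃ C : ℝ, ∀ t : ℝ, |t| ≤ T → ∀ x : Ed d,
      ‖x‖ ^ N * ‖iteratedFDeriv ℝ k (φ t) x‖ ≤ C
  eq : ∀ (t : ℝ) (x : Ed d),
      Complex.I * deriv (fun s => φ s x) t + lap (φ t) x
        = (lam : ℂ) * ((‖φ t x‖ ^ 2 : ℝ) : ℂ) * φ t x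

/-- The momentum density `(P_φ)_j = Im(φ̄ ∂_{x_j} φ)`. -/
noncomputable def Pphi {d : ℕ} (φ : ℝ → Ed d → ℂ) (j : Fin d) (t : ℝ) (x : Ed d) : ℝ :=
  (starRingEnd ℂ (φ t x) * pd j (φ t) x).im


/-! ### Helper material -/

/-- Jointly smooth functions, Schwartz in `x` locally uniformly in `t`. -/
structure KK {d : ℕ} {A : Type} [NormedAddCommGroup A] [NormedSpace ℝ A]
    (F : ℝ → Ed d → A) : Prop where
  smooth : ContDiff ℝ (⊤ : ℕ∞) (fun q : ℝ × Ed d => F q.1 q.2)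
  decay : ∀ (k N : ℕ) (T : ℝ), ∃ C : ℝ, ∀ t : ℝ, |t| ≤ T → ∀ x : Ed d,
      ‖x‖ ^ N * ‖iteratedFDeriv ℝ k (F t) x‖ ≤ C

section helpers

variable {d : ℕ} {A B : Type} [NormedAddCommGroup A] [NormedSpace ℝ A]
  [NormedAddCommGroup B] [NormedSpace ℝ B]

theorem KK.slice {F : ℝ → Ed d → A} (h : KK F) (t : ℝ) : ContDiff ℝ (⊤ : ℕ∞) (F t) :=
  h.smooth.comp (contDiff_prodMk_right t)

theorem KK.diff {F : ℝ → Ed d → A} (h : KK F) (t : ℝ) : Differentiable ℝ (F t) :=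
  (h.slice t).differentiable (by simp)

theorem KK.add {F G : ℝ → Ed d → A} (hF : KK F) (hG : KK G) :
    KK (fun t x => F t x + G t x) := by
  refine ⟨hF.smooth.add hG.smooth, fun k N T => ?_⟩
  obtain ⟨C, hC⟩ := hF.decay k N T
  obtain ⟨D, hD⟩ := hG.decay k N T
  refine ⟨C + D, fun t ht x => ?_⟩
  have e : iteratedFDeriv ℝ k (fun x => F t x + G t x) x
      = iteratedFDeriv ℝ k (F t) x + iteratedFDeriv ℝ k (G t) x :=
    iteratedFDeriv_add_apply ((hF.slice t).contDiffAt.of_le (by exact_mod_cast le_top))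
      ((hG.slice t).contDiffAt.of_le (by exact_mod_cast le_top))
  rw [e]
  calc _ ≤ ‖x‖ ^ N * (‖iteratedFDeriv ℝ k (F t) x‖ + ‖iteratedFDeriv ℝ k (G t) x‖) := by
        gcongr; exact norm_add_le _ _
    _ ≤ _ := by rw [mul_add]; exact add_le_add (hC t ht x) (hD t ht x)

theorem KK.zero : KK (fun (_ : ℝ) (_ : Ed d) => (0 : A)) := by
  refine ⟨contDiff_const, fun k N T => ⟨0, fun t ht x => ?_⟩⟩
  have : iteratedFDeriv ℝ k (fun _ : Ed d => (0 : A)) x = 0 := by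
    simp
  rw [this]; simp

theorem KK.sum {ι : Type} (s : Finset ι) {F : ι → ℝ → Ed d → A} (hF : ∀ i, KK (F i)) :
    KK (fun t x => ∑ i ∈ s, F i t x) := by
  classical
  induction s using Finset.induction_on with
  | empty => simpa using KK.zero
  | insert i s hi ih =>
    simp only [Finset.sum_insert hi]
    exact (hF i).add ih

theorem KK.clm {F : ℝ → Ed d → A} (hF : KK F) (L : A →L[ℝ] B) :
    KK (fun t x => L (F t x)) := by
  refine ⟨L.contDiff.comp hF.smooth, fun k N T => ?_⟩
  obtain ⟨C, hC⟩ := hF.decay k N T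
  refine ⟨‖L‖ * C, fun t ht x => ?_⟩
  have := L.norm_iteratedFDeriv_comp_left (hF.slice t).contDiffAt (x := x) (n := k)
    (by exact_mod_cast le_top)
  calc _ ≤ ‖x‖ ^ N * (‖L‖ * ‖iteratedFDeriv ℝ k (F t) x‖) := by gcongr; exact this
    _ = ‖L‖ * (‖x‖ ^ N * ‖iteratedFDeriv ℝ k (F t) x‖) := by ring
    _ ≤ _ := by gcongr; exact hC t ht x

theorem KK.mul {R : Type} [NormedRing R] [NormedAlgebra ℝ R] {F G : ℝ → Ed d → R}
    (hF : KK F) (hG : KK G) : KK (fun t x => F t x * G t x) := by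
  refine ⟨hF.smooth.mul hG.smooth, fun k N T => ?_⟩
  choose C hC using fun i => hF.decay i N T
  choose D hD using fun i => hG.decay i 0 T
  refine ⟨∑ i ∈ Finset.range (k + 1), (k.choose i : ℝ) * (C i * D (k - i)), fun t ht x => ?_⟩
  have := norm_iteratedFDeriv_mul_le (hF.slice t) (hG.slice t) x (n := k)
    (by exact_mod_cast le_top)
  calc _ ≤ ‖x‖ ^ N * ∑ i ∈ Finset.range (k + 1), (k.choose i : ℝ) *
          ‖iteratedFDeriv ℝ i (F t) x‖ * ‖iteratedFDeriv ℝ (k - i) (G t) x‖ := by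
        gcongr
    _ = ∑ i ∈ Finset.range (k + 1), (k.choose i : ℝ) *
          ((‖x‖ ^ N * ‖iteratedFDeriv ℝ i (F t) x‖) * ‖iteratedFDeriv ℝ (k - i) (G t) x‖) := by
        rw [Finset.mul_sum]; refine Finset.sum_congr rfl fun i _ => by ring
    _ ≤ _ := by
        refine Finset.sum_le_sum fun i _ => ?_
        have h1 := hC i t ht x
        have h2 := hD (k - i) t ht x
        rw [pow_zero, one_mul] at h2
        have h0 : 0 ≤ C i := le_trans (by positivity) h1
        gcongr

theorem KK.dd {F : ℝ → Ed d → A} (hF : KK F) (v : Ed d) :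
    KK (fun t x => fderiv ℝ (F t) x v) := by
  refine ⟨?_, fun k N T => ?_⟩
  · have h : ContDiff ℝ (⊤ : ℕ∞) (Function.uncurry fun (q : ℝ × Ed d) (x : Ed d) => F q.1 x) :=
      hF.smooth.comp ((contDiff_fst.comp contDiff_fst).prodMk contDiff_snd)
    exact h.fderiv_apply contDiff_snd contDiff_const (by simp)
  · obtain ⟨C, hC⟩ := hF.decay (k + 1) N T
    refine ⟨‖v‖ * C, fun t ht x => ?_⟩
    have h1 : ContDiff ℝ (⊤ : ℕ∞) (fderiv ℝ (F t)) := (hF.slice t).fderiv_right (by simp)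
    have := norm_iteratedFDeriv_clm_apply_const (c := v) h1.contDiffAt (x := x) (n := k)
      (by exact_mod_cast le_top)
    rw [norm_iteratedFDeriv_fderiv] at this
    calc _ ≤ ‖x‖ ^ N * (‖v‖ * ‖iteratedFDeriv ℝ (k + 1) (F t) x‖) := by gcongr
      _ = ‖v‖ * (‖x‖ ^ N * ‖iteratedFDeriv ℝ (k + 1) (F t) x‖) := by ring
      _ ≤ _ := by gcongr; exact hC t ht x

theorem KK.pd {F : ℝ → Ed d → ℂ} (hF : KK F) (j : Fin d) : KK (fun t x => pd j (F t) x) :=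
  hF.dd _

theorem KK.rpd {F : ℝ → Ed d → ℝ} (hF : KK F) (j : Fin d) : KK (fun t x => rpd j (F t) x) :=
  hF.dd _

theorem KK.conj {F : ℝ → Ed d → ℂ} (hF : KK F) : KK (fun t x => starRingEnd ℂ (F t x)) :=
  hF.clm (Complex.conjCLE : ℂ →L[ℝ] ℂ)

theorem KK.re {F : ℝ → Ed d → ℂ} (hF : KK F) : KK (fun t x => (F t x).re) :=
  hF.clm Complex.reCLM

theorem KK.im {F : ℝ → Ed d → ℂ} (hF : KK F) : KK (fun t x => (F t x).im) :=
  hF.clm Complex.imCLM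

theorem KK.cmul {R : Type} [NormedRing R] [NormedAlgebra ℝ R] {F : ℝ → Ed d → R}
    (hF : KK F) (c : R) : KK (fun t x => c * F t x) :=
  hF.clm (ContinuousLinearMap.mul ℝ R c)

/-- Uniform bound. -/
theorem KK.bound {F : ℝ → Ed d → A} (hF : KK F) (N : ℕ) (T : ℝ) :
    ∃ C : ℝ, 0 ≤ C ∧ ∀ t : ℝ, |t| ≤ T → ∀ x : Ed d, (1 + ‖x‖) ^ N * ‖F t x‖ ≤ C := by
  obtain ⟨C, hC⟩ := hF.decay 0 0 T
  obtain ⟨D, hD⟩ := hF.decay 0 N T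
  refine ⟨|2 ^ N * (C + D)|, abs_nonneg _, fun t ht x => le_trans ?_ (le_abs_self _)⟩
  have h1 := hC t ht x
  have h2 := hD t ht x
  simp only [norm_iteratedFDeriv_zero, pow_zero, one_mul] at h1 h2
  have h3 : (1 + ‖x‖) ^ N ≤ 2 ^ N * (1 + ‖x‖ ^ N) := by
    rcases le_total ‖x‖ 1 with h | h
    · calc (1 + ‖x‖) ^ N ≤ 2 ^ N := by gcongr; linarith
        _ ≤ _ := le_mul_of_one_le_right (by positivity) (by linarith [pow_nonneg (norm_nonneg x) N])
    · calc (1 + ‖x‖) ^ N ≤ (2 * ‖x‖) ^ N := by gcongr; linarith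
        _ = 2 ^ N * ‖x‖ ^ N := mul_pow _ _ _
        _ ≤ _ := by gcongr; linarith
  calc _ ≤ (2 ^ N * (1 + ‖x‖ ^ N)) * ‖F t x‖ := by gcongr
    _ = 2 ^ N * (‖F t x‖ + ‖x‖ ^ N * ‖F t x‖) := by ring
    _ ≤ _ := by gcongr

/-- Smooth with all derivatives of polynomial growth. -/
structure PG (g : Ed d × Ed d → ℝ) : Prop where
  smooth : ContDiff ℝ (⊤ : ℕ∞) g
  poly : ∀ k : ℕ, ∃ C : ℝ, ∃ m : ℕ, ∀ q : Ed d × Ed d,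
        ‖iteratedFDeriv ℝ k g q‖ ≤ C * (1 + ‖q‖) ^ m

theorem PG.dd {g : Ed d × Ed d → ℝ} (hg : PG g) (v : Ed d × Ed d) :
    PG (fun q => fderiv ℝ g q v) := by
  have h1 : ContDiff ℝ (⊤ : ℕ∞) (fderiv ℝ g) := hg.smooth.fderiv_right (by simp)
  refine ⟨h1.clm_apply contDiff_const, fun k => ?_⟩
  obtain ⟨C, m, hC⟩ := hg.poly (k + 1)
  refine ⟨‖v‖ * C, m, fun q => ?_⟩
  have := norm_iteratedFDeriv_clm_apply_const (c := v) h1.contDiffAt (x := q) (n := k)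
      (by exact_mod_cast le_top)
  rw [norm_iteratedFDeriv_fderiv] at this
  calc _ ≤ _ := this
    _ ≤ ‖v‖ * (C * (1 + ‖q‖) ^ m) := by gcongr; exact hC q
    _ = _ := by ring

theorem PG.pdx {g : Ed d × Ed d → ℝ} (hg : PG g) (j : Fin d) : PG (pdx j g) := hg.dd _
theorem PG.pdy {g : Ed d × Ed d → ℝ} (hg : PG g) (j : Fin d) : PG (pdy j g) := hg.dd _

/-- Integrable weight. -/
def ww (d : ℕ) (q : Ed d × Ed d) : ℝ :=
  (1 + ‖q.1‖) ^ (-((d : ℝ) + 1)) * (1 + ‖q.2‖) ^ (-((d : ℝ) + 1))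

theorem ww_integrable (d : ℕ) : Integrable (ww d) := by
  have h : Integrable (fun x : Ed d => (1 + ‖x‖) ^ (-((d : ℝ) + 1))) :=
    integrable_one_add_norm (by simp)
  exact h.mul_prod h

theorem key_bound {g : Ed d × Ed d → ℝ} (hg : PG g) {F H : ℝ → Ed d → ℝ} (hF : KK F)
    (hH : KK H) (T : ℝ) : ∃ C : ℝ, ∀ t : ℝ, |t| ≤ T → ∀ q : Ed d × Ed d,
      ‖g q * (F t q.1 * H t q.2)‖ ≤ C * ww d q := by
  obtain ⟨C, m, hC⟩ := hg.poly 0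
  simp only [norm_iteratedFDeriv_zero] at hC
  have hC0 : 0 ≤ C := by
    have := (norm_nonneg _).trans (hC 0)
    simpa using this
  obtain ⟨D, hD0, hD⟩ := hF.bound (m + (d + 1)) T
  obtain ⟨E, hE0, hE⟩ := hH.bound (m + (d + 1)) T
  refine ⟨C * D * E, fun t ht q => ?_⟩
  have h1 := hD t ht q.1
  have h2 := hE t ht q.2
  have hx : 0 < 1 + ‖q.1‖ := by positivity
  have hy : 0 < 1 + ‖q.2‖ := by positivity
  have hw : ∀ r : ℝ, 0 < r → r ^ (-((d : ℝ) + 1)) = (r ^ (d + 1))⁻¹ := fun r hr => by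
    rw [Real.rpow_neg hr.le]; congr 1; exact_mod_cast Real.rpow_natCast r (d + 1)
  have hq : 1 + ‖q‖ ≤ (1 + ‖q.1‖) * (1 + ‖q.2‖) := by
    have : ‖q‖ ≤ ‖q.1‖ + ‖q.2‖ := by
      rw [Prod.norm_def]
      exact max_le (by linarith [norm_nonneg q.2]) (by linarith [norm_nonneg q.1])
    nlinarith [norm_nonneg q.1, norm_nonneg q.2, mul_nonneg (norm_nonneg q.1) (norm_nonneg q.2)]
  have h1' : (1 + ‖q.1‖) ^ m * ‖F t q.1‖ ≤ D * (1 + ‖q.1‖) ^ (-((d : ℝ) + 1)) := by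
    rw [hw _ hx, ← div_eq_mul_inv, le_div_iff₀ (by positivity)]
    calc _ = (1 + ‖q.1‖) ^ (m + (d + 1)) * ‖F t q.1‖ := by ring
      _ ≤ _ := h1
  have h2' : (1 + ‖q.2‖) ^ m * ‖H t q.2‖ ≤ E * (1 + ‖q.2‖) ^ (-((d : ℝ) + 1)) := by
    rw [hw _ hy, ← div_eq_mul_inv, le_div_iff₀ (by positivity)]
    calc _ = (1 + ‖q.2‖) ^ (m + (d + 1)) * ‖H t q.2‖ := by ring
      _ ≤ _ := h2
  rw [norm_mul, norm_mul]
  calc _ ≤ (C * ((1 + ‖q.1‖) * (1 + ‖q.2‖)) ^ m) * (‖F t q.1‖ * ‖H t q.2‖) := by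
        gcongr
        exact (hC q).trans (by gcongr)
    _ = C * (((1 + ‖q.1‖) ^ m * ‖F t q.1‖) * ((1 + ‖q.2‖) ^ m * ‖H t q.2‖)) := by
        rw [mul_pow]; ring
    _ ≤ C * ((D * (1 + ‖q.1‖) ^ (-((d : ℝ) + 1))) * (E * (1 + ‖q.2‖) ^ (-((d : ℝ) + 1)))) := by
        gcongr
    _ = _ := by unfold ww; ring

theorem key_meas {g : Ed d × Ed d → ℝ} (hg : PG g) {F H : ℝ → Ed d → ℝ} (hF : KK F)
    (hH : KK H) (t : ℝ) : AEStronglyMeasurable (fun q : Ed d × Ed d => g q * (F t q.1 * H t q.2)) := by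
  have h1 := (hF.slice t).continuous
  have h2 := (hH.slice t).continuous
  have h3 := hg.smooth.continuous
  have : Continuous (fun q : Ed d × Ed d => g q * (F t q.1 * H t q.2)) := by fun_prop
  exact this.aestronglyMeasurable

theorem key_int {g : Ed d × Ed d → ℝ} (hg : PG g) {F H : ℝ → Ed d → ℝ} (hF : KK F)
    (hH : KK H) (t : ℝ) : Integrable (fun q : Ed d × Ed d => g q * (F t q.1 * H t q.2)) := by
  obtain ⟨C, hC⟩ := key_bound hg hF hH |t|
  exact ((ww_integrable d).const_mul C).mono' (key_meas hg hF hH t)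
    (Filter.Eventually.of_forall fun q => hC t le_rfl q)

/-- The bilinear functional. -/
def JJ (g : Ed d × Ed d → ℝ) (F H : Ed d → ℝ) : ℝ :=
  ∫ q : Ed d × Ed d, g q * (F q.1 * H q.2)

theorem ibp_x {g : Ed d × Ed d → ℝ} (hg : PG g) {F H : ℝ → Ed d → ℝ} (hF : KK F)
    (hH : KK H) (t : ℝ) (j : Fin d) :
    JJ g (rpd j (F t)) (H t) = - JJ (pdx j g) (F t) (H t) := by
  have hd : ∀ q : Ed d × Ed d, HasFDerivAt (fun q : Ed d × Ed d => F t q.1 * H t q.2)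
      (F t q.1 • ((fderiv ℝ (H t) q.2).comp (ContinuousLinearMap.snd ℝ _ _))
        + H t q.2 • ((fderiv ℝ (F t) q.1).comp (ContinuousLinearMap.fst ℝ _ _))) q := fun q =>
    (((hF.diff t) q.1).hasFDerivAt.comp q hasFDerivAt_fst).mul
      (((hH.diff t) q.2).hasFDerivAt.comp q hasFDerivAt_snd)
  have he : ∀ q : Ed d × Ed d, fderiv ℝ (fun q : Ed d × Ed d => F t q.1 * H t q.2) q
      (EuclideanSpace.single j 1, 0) = rpd j (F t) q.1 * H t q.2 := fun q => by
    rw [(hd q).fderiv]; simp [rpd, mul_comm]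
  unfold JJ
  have : (volume : Measure (Ed d × Ed d)).IsAddHaarMeasure :=
    Measure.prod.instIsAddHaarMeasure _ _
  have := integral_mul_fderiv_eq_neg_fderiv_mul_of_integrable (μ := (volume : Measure (Ed d × Ed d)))
    (f := g) (g := fun q : Ed d × Ed d => F t q.1 * H t q.2)
    (v := (EuclideanSpace.single j 1, 0)) (key_int (hg.pdx j) hF hH t)
    (by simpa only [he] using key_int hg (hF.rpd j) hH t) (key_int hg hF hH t)
    (fun q _ => hg.smooth.differentiable (by simp) q)
    (fun q _ => (hd q).differentiableAt)
  simp only [he] at this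
  exact this

theorem ibp_y {g : Ed d × Ed d → ℝ} (hg : PG g) {F H : ℝ → Ed d → ℝ} (hF : KK F)
    (hH : KK H) (t : ℝ) (j : Fin d) :
    JJ g (F t) (rpd j (H t)) = - JJ (pdy j g) (F t) (H t) := by
  have hd : ∀ q : Ed d × Ed d, HasFDerivAt (fun q : Ed d × Ed d => F t q.1 * H t q.2)
      (F t q.1 • ((fderiv ℝ (H t) q.2).comp (ContinuousLinearMap.snd ℝ _ _))
        + H t q.2 • ((fderiv ℝ (F t) q.1).comp (ContinuousLinearMap.fst ℝ _ _))) q := fun q =>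
    (((hF.diff t) q.1).hasFDerivAt.comp q hasFDerivAt_fst).mul
      (((hH.diff t) q.2).hasFDerivAt.comp q hasFDerivAt_snd)
  have he : ∀ q : Ed d × Ed d, fderiv ℝ (fun q : Ed d × Ed d => F t q.1 * H t q.2) q
      (0, EuclideanSpace.single j 1) = F t q.1 * rpd j (H t) q.2 := fun q => by
    rw [(hd q).fderiv]; simp [rpd]
  unfold JJ
  have : (volume : Measure (Ed d × Ed d)).IsAddHaarMeasure :=
    Measure.prod.instIsAddHaarMeasure _ _
  have := integral_mul_fderiv_eq_neg_fderiv_mul_of_integrable (μ := (volume : Measure (Ed d × Ed d)))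
    (f := g) (g := fun q : Ed d × Ed d => F t q.1 * H t q.2)
    (v := (0, EuclideanSpace.single j 1)) (key_int (hg.pdy j) hF hH t)
    (by simpa only [he] using key_int hg hF (hH.rpd j) t) (key_int hg hF hH t)
    (fun q _ => hg.smooth.differentiable (by simp) q)
    (fun q _ => (hd q).differentiableAt)
  simp only [he] at this
  exact this

theorem JJ_hasDerivAt {g : Ed d × Ed d → ℝ} (hg : PG g) {F H F' H' : ℝ → Ed d → ℝ} (hF : KK F)
    (hH : KK H) (hF' : KK F') (hH' : KK H')
    (dF : ∀ s x, HasDerivAt (fun s => F s x) (F' s x) s)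
    (dH : ∀ s x, HasDerivAt (fun s => H s x) (H' s x) s) (t : ℝ) :
    HasDerivAt (fun s => JJ g (F s) (H s)) (JJ g (F' t) (H t) + JJ g (F t) (H' t)) t := by
  obtain ⟨C, hC⟩ := key_bound hg hF' hH (|t| + 1)
  obtain ⟨D, hD⟩ := key_bound hg hF hH' (|t| + 1)
  have i1 := key_int hg hF' hH t
  have i2 := key_int hg hF hH' t
  have := (hasDerivAt_integral_of_dominated_loc_of_deriv_le
    (μ := (volume : Measure (Ed d × Ed d))) (s := Metric.ball t 1) (x₀ := t)
    (F := fun s q => g q * (F s q.1 * H s q.2))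
    (F' := fun s q => g q * (F' s q.1 * H s q.2) + g q * (F s q.1 * H' s q.2))
    (bound := fun q => C * ww d q + D * ww d q)
    (Metric.ball_mem_nhds t one_pos)
    (Filter.Eventually.of_forall fun s => key_meas hg hF hH s) (key_int hg hF hH t)
    ((key_meas hg hF' hH t).add (key_meas hg hF hH' t))
    (Filter.Eventually.of_forall fun q s hs => ?_)
    (((ww_integrable d).const_mul C).add ((ww_integrable d).const_mul D))
    (Filter.Eventually.of_forall fun q s hs => ?_)).2
  · rw [integral_add i1 i2] at this
    exact this
  · have hs' : |s| ≤ |t| + 1 := by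
      rw [Metric.mem_ball, Real.dist_eq] at hs
      have := abs_sub_abs_le_abs_sub s t
      linarith
    exact (norm_add_le _ _).trans (add_le_add (hC s hs' q) (hD s hs' q))
  · have := ((dF s q.1).mul (dH s q.2)).const_mul (g q)
    rw [mul_add] at this
    exact this

theorem iter_eq {f : Ed d × Ed d → ℝ} (hf : Integrable f) :
    ∫ x : Ed d, ∫ y : Ed d, f (x, y) = ∫ q, f q :=
  (integral_prod f hf).symm

theorem JJ_sum_F {ι : Type} (s : Finset ι) {g : Ed d × Ed d → ℝ} (hg : PG g)
    {F : ι → ℝ → Ed d → ℝ} {H : ℝ → Ed d → ℝ} (hF : ∀ i, KK (F i)) (hH : KK H) (t : ℝ) :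
    JJ g (fun x => ∑ i ∈ s, F i t x) (H t) = ∑ i ∈ s, JJ g (F i t) (H t) := by
  unfold JJ
  rw [← integral_finsetSum s fun i _ => key_int hg (hF i) hH t]
  simp only [Finset.sum_mul, Finset.mul_sum]

theorem JJ_sum_H {ι : Type} (s : Finset ι) {g : Ed d × Ed d → ℝ} (hg : PG g)
    {F : ℝ → Ed d → ℝ} {H : ι → ℝ → Ed d → ℝ} (hF : KK F) (hH : ∀ i, KK (H i)) (t : ℝ) :
    JJ g (F t) (fun x => ∑ i ∈ s, H i t x) = ∑ i ∈ s, JJ g (F t) (H i t) := by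
  unfold JJ
  rw [← integral_finsetSum s fun i _ => key_int hg hF (hH i) t]
  simp only [Finset.mul_sum]

theorem JJ_cmul_F (c : ℝ) (g : Ed d × Ed d → ℝ) (F H : Ed d → ℝ) :
    JJ g (fun x => c * F x) H = c * JJ g F H := by
  unfold JJ
  rw [← integral_const_mul]; congr 1; ext q; ring

theorem JJ_cmul_H (c : ℝ) (g : Ed d × Ed d → ℝ) (F H : Ed d → ℝ) :
    JJ g F (fun x => c * H x) = c * JJ g F H := by
  unfold JJ
  rw [← integral_const_mul]; congr 1; ext q; ring

theorem JJ_add_F {g : Ed d × Ed d → ℝ} (hg : PG g)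
    {F G : ℝ → Ed d → ℝ} {H : ℝ → Ed d → ℝ} (hF : KK F) (hG : KK G) (hH : KK H) (t : ℝ) :
    JJ g (fun x => F t x + G t x) (H t) = JJ g (F t) (H t) + JJ g (G t) (H t) := by
  unfold JJ
  rw [← integral_add (key_int hg hF hH t) (key_int hg hG hH t)]
  congr 1; ext q; ring

/-- Symmetry of second derivatives. -/
theorem snd_symm {E : Type} [NormedAddCommGroup E] [NormedSpace ℝ E] {f : E → A}
    (hf : ContDiff ℝ (⊤ : ℕ∞) f) (v w z : E) :
    fderiv ℝ (fun u => fderiv ℝ f u v) z w = fderiv ℝ (fun u => fderiv ℝ f u w) z v := by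
  have h1 : ContDiff ℝ (⊤ : ℕ∞) (fderiv ℝ f) := hf.fderiv_right (by simp)
  have h2 : DifferentiableAt ℝ (fderiv ℝ f) z := h1.differentiable (by simp) z
  have hs : IsSymmSndFDerivAt ℝ f z := hf.contDiffAt.isSymmSndFDerivAt (by
    simp only [minSmoothness_of_isRCLikeNormedField]
    exact WithTop.coe_le_coe.2 (le_top : (2 : ℕ∞) ≤ ⊤))
  have e : ∀ v w : E, fderiv ℝ (fun u => fderiv ℝ f u v) z w = fderiv ℝ (fderiv ℝ f) z w v := by
    intro v w
    rw [fderiv_clm_apply h2 (differentiableAt_const v)]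
    simp
  rw [e, e]
  exact hs.eq w v

theorem pdx_pdy {g : Ed d × Ed d → ℝ} (hg : PG g) (j l : Fin d) :
    pdy l (pdx j g) = pdx j (pdy l g) := by
  ext q
  exact snd_symm hg.smooth _ _ _

theorem pd_symm {f : Ed d → ℂ} (hf : ContDiff ℝ (⊤ : ℕ∞) f) (j l : Fin d) (x : Ed d) :
    pd l (pd j f) x = pd j (pd l f) x :=
  snd_symm hf _ _ _

theorem slice_t {f : ℝ × Ed d → A} (hf : Differentiable ℝ f) (t : ℝ) (x : Ed d) :
    HasDerivAt (fun s => f (s, x)) (fderiv ℝ f (t, x) (1, 0)) t :=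
  (hf (t, x)).hasFDerivAt.comp_hasDerivAt t ((hasDerivAt_id t).prodMk (hasDerivAt_const t x))

theorem slice_x {f : ℝ × Ed d → A} (hf : Differentiable ℝ f) (t : ℝ) (x v : Ed d) :
    fderiv ℝ (fun y => f (t, y)) x v = fderiv ℝ f (t, x) (0, v) := by
  have := (hf (t, x)).hasFDerivAt.comp x ((hasFDerivAt_const t x).prodMk (hasFDerivAt_id x))
  have e := this.fderiv
  have e2 : fderiv ℝ (fun y => f (t, y)) x = _ := e
  rw [e2]; simp

theorem dt_dd {F G : ℝ → Ed d → A} (hF : KK F) (hG : KK G)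
    (h : ∀ s x, deriv (fun s => F s x) s = G s x) (v : Ed d) (t : ℝ) (x : Ed d) :
    HasDerivAt (fun s => fderiv ℝ (F s) x v) (fderiv ℝ (G t) x v) t := by
  set f : ℝ × Ed d → A := fun q => F q.1 q.2 with hf
  have df : Differentiable ℝ f := hF.smooth.differentiable (by simp)
  have h1 : ContDiff ℝ (⊤ : ℕ∞) (fun q => fderiv ℝ f q (0, v)) :=
    (hF.smooth.fderiv_right (m := (⊤ : ℕ∞)) (by simp)).clm_apply contDiff_const
  have h2 := slice_t (h1.differentiable (by simp)) t x
  have e1 : (fun s => fderiv ℝ (F s) x v) = fun s => fderiv ℝ f (s, x) (0, v) := by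
    ext s; exact slice_x df s x v
  have e2 : (fun q => fderiv ℝ f q (1, 0)) = fun q : ℝ × Ed d => G q.1 q.2 := by
    ext q; rw [← h q.1 q.2]; exact (slice_t df q.1 q.2).deriv.symm
  rw [e1]
  rw [snd_symm hF.smooth, e2, ← slice_x (hG.smooth.differentiable (by simp))] at h2
  exact h2

/-- real bilinear form -/
def BB (f g : Ed d → ℂ) (x : Ed d) : ℝ := (f x * starRingEnd ℂ (g x)).re

theorem rpd_add {f g : Ed d → ℝ} (hf : Differentiable ℝ f) (hg : Differentiable ℝ g) (j : Fin d)
    (x : Ed d) : rpd j (fun x => f x + g x) x = rpd j f x + rpd j g x := by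
  unfold rpd; rw [fderiv_fun_add (hf x) (hg x)]; rfl

theorem rpd_mul {f g : Ed d → ℝ} (hf : Differentiable ℝ f) (hg : Differentiable ℝ g) (j : Fin d)
    (x : Ed d) : rpd j (fun x => f x * g x) x = rpd j f x * g x + f x * rpd j g x := by
  unfold rpd; rw [fderiv_fun_mul (hf x) (hg x)]; simp; ring

theorem rpd_sum {f : Fin d → Ed d → ℝ} (hf : ∀ k, Differentiable ℝ (f k)) (j : Fin d)
    (x : Ed d) : rpd j (fun x => ∑ k, f k x) x = ∑ k, rpd j (f k) x := by
  unfold rpd; rw [fderiv_fun_sum (fun k _ => hf k x)]; simp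

theorem pd_add {f g : Ed d → ℂ} (hf : Differentiable ℝ f) (hg : Differentiable ℝ g) (j : Fin d)
    (x : Ed d) : pd j (fun x => f x + g x) x = pd j f x + pd j g x := by
  unfold pd; rw [fderiv_fun_add (hf x) (hg x)]; rfl

theorem pd_mul {f g : Ed d → ℂ} (hf : Differentiable ℝ f) (hg : Differentiable ℝ g) (j : Fin d)
    (x : Ed d) : pd j (fun x => f x * g x) x = pd j f x * g x + f x * pd j g x := by
  unfold pd; rw [fderiv_fun_mul (hf x) (hg x)]; simp; ring

theorem pd_cmul {f : Ed d → ℂ} (hf : Differentiable ℝ f) (c : ℂ) (j : Fin d)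
    (x : Ed d) : pd j (fun x => c * f x) x = c * pd j f x := by
  rw [pd_mul (differentiable_const c) hf]; simp [pd]

theorem pd_sum {f : Fin d → Ed d → ℂ} (hf : ∀ k, Differentiable ℝ (f k)) (j : Fin d)
    (x : Ed d) : pd j (fun x => ∑ k, f k x) x = ∑ k, pd j (f k) x := by
  unfold pd; rw [fderiv_fun_sum (fun k _ => hf k x)]; simp

theorem diff_conj {f : Ed d → ℂ} (hf : Differentiable ℝ f) :
    Differentiable ℝ (fun x => starRingEnd ℂ (f x)) :=
  (Complex.conjCLE : ℂ →L[ℝ] ℂ).differentiable.comp hf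

theorem pd_conj {f : Ed d → ℂ} (hf : Differentiable ℝ f) (j : Fin d) (x : Ed d) :
    pd j (fun x => starRingEnd ℂ (f x)) x = starRingEnd ℂ (pd j f x) := by
  have := ((Complex.conjCLE : ℂ →L[ℝ] ℂ).hasFDerivAt.comp x (hf x).hasFDerivAt).fderiv
  have e : fderiv ℝ (fun x => starRingEnd ℂ (f x)) x = _ := this
  unfold pd; rw [e]; simp

theorem diff_BB {f g : Ed d → ℂ} (hf : Differentiable ℝ f) (hg : Differentiable ℝ g) :
    Differentiable ℝ (BB f g) :=
  Complex.reCLM.differentiable.comp (hf.fun_mul (diff_conj hg))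

theorem rpd_re {f : Ed d → ℂ} (hf : Differentiable ℝ f) (j : Fin d) (x : Ed d) :
    rpd j (fun x => (f x).re) x = (pd j f x).re := by
  have := (Complex.reCLM.hasFDerivAt.comp x (hf x).hasFDerivAt).fderiv
  have e : fderiv ℝ (fun x => (f x).re) x = _ := this
  unfold rpd pd; rw [e]; simp

theorem rpd_im {f : Ed d → ℂ} (hf : Differentiable ℝ f) (j : Fin d) (x : Ed d) :
    rpd j (fun x => (f x).im) x = (pd j f x).im := by
  have := (Complex.imCLM.hasFDerivAt.comp x (hf x).hasFDerivAt).fderiv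
  have e : fderiv ℝ (fun x => (f x).im) x = _ := this
  unfold rpd pd; rw [e]; simp

theorem rpd_BB {f g : Ed d → ℂ} (hf : Differentiable ℝ f) (hg : Differentiable ℝ g) (j : Fin d) :
    rpd j (BB f g) = fun x => BB (pd j f) g x + BB f (pd j g) x := by
  ext x
  unfold BB
  rw [rpd_re (hf.fun_mul (diff_conj hg)), pd_mul hf (diff_conj hg), pd_conj hg]
  simp

theorem nsq (z : ℂ) : ‖z‖ ^ 2 = (z * starRingEnd ℂ z).re := by
  rw [Complex.mul_conj, Complex.normSq_eq_norm_sq]; simp only [Complex.ofReal_re]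

/-- Right-hand side of the momentum equation. -/
def QQ (lam : ℝ) (φ : ℝ → Ed d → ℂ) (j : Fin d) (t : ℝ) (x : Ed d) : ℝ :=
  (-2) * (∑ k, rpd k (BB (pd j (φ t)) (pd k (φ t))) x)
    + ((1 / 2) * rpd j (rlap (BB (φ t) (φ t))) x
      + (-(lam / 2)) * rpd j (fun w => BB (φ t) (φ t) w * BB (φ t) (φ t) w) x)

/-- time derivative of the solution -/
def NN (lam : ℝ) (φ : ℝ → Ed d → ℂ) (t : ℝ) (x : Ed d) : ℂ :=
  (∑ k, Complex.I * pd k (pd k (φ t)) x)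
    + (-(Complex.I * lam)) * (φ t x * starRingEnd ℂ (φ t x) * φ t x)

variable {lam : ℝ} {φ : ℝ → Ed d → ℂ}

theorem toKK (hφ : CubicNLSSolution d lam φ) : KK φ := ⟨hφ.smooth, hφ.decay⟩

theorem KK.NN (h : KK φ) : KK (NN lam φ) :=
  (KK.sum _ fun k => ((h.pd k).pd k).cmul Complex.I).add (((h.mul h.conj).mul h).cmul _)

theorem nls_deriv_eq (hφ : CubicNLSSolution d lam φ) (s : ℝ) (x : Ed d) :
    deriv (fun s => φ s x) s = NN lam φ s x := by
  have h := hφ.eq s x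
  unfold NN
  rw [Complex.mul_conj, Complex.normSq_eq_norm_sq, ← Finset.mul_sum]
  unfold lap at h
  linear_combination (-Complex.I) * h + (deriv (fun s => φ s x) s) * Complex.I_mul_I

theorem hasDeriv_phi (hφ : CubicNLSSolution d lam φ) (s : ℝ) (x : Ed d) :
    HasDerivAt (fun s => φ s x) (NN lam φ s x) s := by
  rw [← nls_deriv_eq hφ]
  exact (slice_t (f := fun q => φ q.1 q.2)
    (hφ.smooth.differentiable (by simp)) s x).differentiableAt.hasDerivAt

theorem hasDeriv_pd (hφ : CubicNLSSolution d lam φ) (j : Fin d) (s : ℝ) (x : Ed d) :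
    HasDerivAt (fun s => pd j (φ s) x) (pd j (NN lam φ s) x) s :=
  dt_dd (toKK hφ) (toKK hφ).NN (nls_deriv_eq hφ) _ s x

theorem hasDeriv_conj {f : ℝ → ℂ} {f' : ℂ} {s : ℝ} (h : HasDerivAt f f' s) :
    HasDerivAt (fun s => starRingEnd ℂ (f s)) (starRingEnd ℂ f') s :=
  (Complex.conjCLE : ℂ →L[ℝ] ℂ).hasFDerivAt.comp_hasDerivAt s h

theorem rpd_P (hφ : CubicNLSSolution d lam φ) (l : Fin d) (s : ℝ) (x : Ed d) :
    rpd l (Pphi φ l s) x = (starRingEnd ℂ (φ s x) * pd l (pd l (φ s)) x).im := by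
  have h := toKK hφ
  have d0 := h.diff s
  have d1 : Differentiable ℝ (pd l (φ s)) := (h.pd l).diff s
  have : Pphi φ l s = fun x => (starRingEnd ℂ (φ s x) * pd l (φ s) x).im := rfl
  rw [this, rpd_im ((diff_conj d0).fun_mul d1), pd_mul (diff_conj d0) d1, pd_conj d0]
  simp only [Complex.add_im, Complex.mul_im, Complex.conj_re, Complex.conj_im]
  ring

theorem hasDeriv_rho (hφ : CubicNLSSolution d lam φ) (s : ℝ) (x : Ed d) :
    HasDerivAt (fun s => BB (φ s) (φ s) x) (∑ l, (-2) * rpd l (Pphi φ l s) x) s := by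
  have h0 := hasDeriv_phi hφ s x
  have h1 := Complex.reCLM.hasFDerivAt.comp_hasDerivAt s (h0.mul (hasDeriv_conj h0))
  refine h1.congr_deriv ?_
  simp only [rpd_P hφ]
  have e : ∀ z w : ℂ, Complex.reCLM (w * starRingEnd ℂ z + z * starRingEnd ℂ w)
      = 2 * (w * starRingEnd ℂ z).re := fun z w => by
    simp; ring
  rw [e]
  unfold NN
  rw [add_mul, Complex.add_re, Finset.sum_mul, Complex.re_sum]
  have z : (-(Complex.I * lam) * (φ s x * starRingEnd ℂ (φ s x) * φ s x) *
      starRingEnd ℂ (φ s x)).re = 0 := by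
    simp; ring
  rw [z, add_zero, Finset.mul_sum]
  refine Finset.sum_congr rfl fun l _ => ?_
  simp; ring

theorem hasDeriv_P (hφ : CubicNLSSolution d lam φ) (j : Fin d) (s : ℝ) (x : Ed d) :
    HasDerivAt (fun s => Pphi φ j s x) (QQ lam φ j s x) s := by
  have h := toKK hφ
  have d0 := h.diff s
  have d1 : ∀ k, Differentiable ℝ (pd k (φ s)) := fun k => (h.pd k).diff s
  have d2 : ∀ k l, Differentiable ℝ (pd l (pd k (φ s))) := fun k l => ((h.pd k).pd l).diff s
  have h0 := hasDeriv_phi hφ s x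
  have h1 := Complex.imCLM.hasFDerivAt.comp_hasDerivAt s
    ((hasDeriv_conj h0).mul (hasDeriv_pd hφ j s x))
  refine h1.congr_deriv ?_
  have e1 : pd j (NN lam φ s) x = (∑ k, Complex.I * pd j (pd k (pd k (φ s))) x)
      + (-(Complex.I * lam)) * ((pd j (φ s) x * starRingEnd ℂ (φ s x)
        + φ s x * starRingEnd ℂ (pd j (φ s) x)) * φ s x
        + φ s x * starRingEnd ℂ (φ s x) * pd j (φ s) x) := by
    have : NN lam φ s = fun x => (∑ k, Complex.I * pd k (pd k (φ s)) x)
        + (-(Complex.I * lam)) * (φ s x * starRingEnd ℂ (φ s x) * φ s x) := rfl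
    have m1 : Differentiable ℝ fun x => φ s x * starRingEnd ℂ (φ s x) := d0.fun_mul (diff_conj d0)
    have m2 : Differentiable ℝ fun x => φ s x * starRingEnd ℂ (φ s x) * φ s x := m1.mul d0
    have m3 : ∀ k, Differentiable ℝ fun x => Complex.I * pd k (pd k (φ s)) x :=
      fun k => (d2 k k).const_mul _
    rw [this, pd_add (Differentiable.fun_sum fun k _ => m3 k) (m2.const_mul _),
      pd_sum m3, pd_cmul m2, pd_mul m1 d0, pd_mul d0 (diff_conj d0), pd_conj d0]
    congr 1
    exact Finset.sum_congr rfl fun k _ => pd_cmul (d2 k k) _ _ _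
  have b1 : ∀ k, rpd k (BB (pd j (φ s)) (pd k (φ s))) x
      = BB (pd j (pd k (φ s))) (pd k (φ s)) x + BB (pd j (φ s)) (pd k (pd k (φ s))) x := fun k => by
    rw [rpd_BB (d1 j) (d1 k)]
    have : pd k (pd j (φ s)) = pd j (pd k (φ s)) := by
      ext y; exact pd_symm (h.slice s) _ _ _
    rw [this]
  have b2 : rlap (BB (φ s) (φ s)) = fun x => ∑ k,
      ((BB (pd k (pd k (φ s))) (φ s) x + BB (pd k (φ s)) (pd k (φ s)) x)
        + (BB (pd k (φ s)) (pd k (φ s)) x + BB (φ s) (pd k (pd k (φ s))) x)) := by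
    ext x
    unfold rlap
    refine Finset.sum_congr rfl fun k _ => ?_
    rw [rpd_BB d0 d0, rpd_add (diff_BB (d1 k) d0) (diff_BB d0 (d1 k)), rpd_BB (d1 k) d0,
      rpd_BB d0 (d1 k)]
  have b3 : rpd j (rlap (BB (φ s) (φ s))) x = ∑ k,
      (((BB (pd j (pd k (pd k (φ s)))) (φ s) x + BB (pd k (pd k (φ s))) (pd j (φ s)) x)
        + (BB (pd j (pd k (φ s))) (pd k (φ s)) x + BB (pd k (φ s)) (pd j (pd k (φ s))) x))
       + ((BB (pd j (pd k (φ s))) (pd k (φ s)) x + BB (pd k (φ s)) (pd j (pd k (φ s))) x)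
        + (BB (pd j (φ s)) (pd k (pd k (φ s))) x + BB (φ s) (pd j (pd k (pd k (φ s)))) x))) := by
    have c1 := fun k => diff_BB (d2 k k) d0
    have c2 := fun k => diff_BB (d1 k) (d1 k)
    have c3 := fun k => diff_BB d0 (d2 k k)
    rw [b2, rpd_sum fun k => ((c1 k).fun_add (c2 k)).fun_add ((c2 k).fun_add (c3 k))]
    refine Finset.sum_congr rfl fun k _ => ?_
    rw [rpd_add ((c1 k).fun_add (c2 k)) ((c2 k).fun_add (c3 k)), rpd_add (c1 k) (c2 k),
      rpd_add (c2 k) (c3 k), rpd_BB (d2 k k) d0, rpd_BB (d1 k) (d1 k), rpd_BB d0 (d2 k k)]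
  unfold QQ
  rw [b3, rpd_mul (diff_BB d0 d0) (diff_BB d0 d0), rpd_BB d0 d0, e1]
  simp only [b1]
  have lin : (-2) * (∑ k, (BB (pd j (pd k (φ s))) (pd k (φ s)) x
        + BB (pd j (φ s)) (pd k (pd k (φ s))) x))
      + (1 / 2) * ∑ k,
      (((BB (pd j (pd k (pd k (φ s)))) (φ s) x + BB (pd k (pd k (φ s))) (pd j (φ s)) x)
        + (BB (pd j (pd k (φ s))) (pd k (φ s)) x + BB (pd k (φ s)) (pd j (pd k (φ s))) x))
       + ((BB (pd j (pd k (φ s))) (pd k (φ s)) x + BB (pd k (φ s)) (pd j (pd k (φ s))) x)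
        + (BB (pd j (φ s)) (pd k (pd k (φ s))) x + BB (φ s) (pd j (pd k (pd k (φ s)))) x)))
      = (starRingEnd ℂ (∑ k, Complex.I * pd k (pd k (φ s)) x) * pd j (φ s) x
        + starRingEnd ℂ (φ s x) * (∑ k, Complex.I * pd j (pd k (pd k (φ s))) x)).im := by
    rw [map_sum, Finset.sum_mul, Finset.mul_sum, Finset.mul_sum, Finset.mul_sum,
      ← Finset.sum_add_distrib, ← Finset.sum_add_distrib, Complex.im_sum]
    refine Finset.sum_congr rfl fun k _ => ?_
    simp only [BB, Complex.add_im, Complex.mul_im, Complex.mul_re, Complex.conj_re,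
      Complex.conj_im, Complex.I_re, Complex.I_im]
    ring
  rw [← add_assoc, lin]
  unfold NN
  generalize (∑ k, Complex.I * pd k (pd k (φ s)) x) = S
  generalize (∑ k, Complex.I * pd j (pd k (pd k (φ s))) x) = S'
  simp only [BB, Complex.imCLM_apply, map_add, map_mul, map_neg, Complex.conj_I,
    Complex.conj_ofReal, Complex.conj_conj, Complex.add_im, Complex.add_re, Complex.mul_im,
    Complex.mul_re, Complex.conj_re, Complex.neg_re, Complex.neg_im,
      Complex.conj_im, Complex.I_re, Complex.I_im, Complex.ofReal_re, Complex.ofReal_im]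
  ring

theorem iter_sum {ι : Type} [Fintype ι] {g : ι → Ed d × Ed d → ℝ} (hg : ∀ i, PG (g i))
    {F H : ι → ℝ → Ed d → ℝ} (hF : ∀ i, KK (F i)) (hH : ∀ i, KK (H i)) (t : ℝ)
    (f : Ed d → Ed d → ℝ) (e : ∀ x y, f x y = ∑ i, g i (x, y) * (F i t x * H i t y)) :
    ∫ x : Ed d, ∫ y : Ed d, f x y = ∑ i, JJ (g i) (F i t) (H i t) := by
  have hi := fun i => key_int (hg i) (hF i) (hH i) t
  simp only [e]
  rw [iter_eq (f := fun q => ∑ i, g i q * (F i t q.1 * H i t q.2))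
    (integrable_finsetSum _ fun i _ => hi i), integral_finsetSum _ fun i _ => hi i]
  rfl

theorem KK.BB {f g : ℝ → Ed d → ℂ} (hf : KK f) (hg : KK g) : KK (fun t => BB (f t) (g t)) :=
  (hf.mul hg.conj).re

theorem KK.rlap {f : ℝ → Ed d → ℝ} (hf : KK f) : KK (fun t => rlap (f t)) :=
  KK.sum _ fun k => (hf.rpd k).rpd k

theorem KK.P (h : KK φ) (j : Fin d) : KK (Pphi φ j) := (h.conj.mul (h.pd j)).im

theorem KK.QQ (h : KK φ) (j : Fin d) : KK (QQ lam φ j) :=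
  ((KK.sum _ fun k => ((h.pd j).BB (h.pd k)).rpd k).cmul (-2)).add
    ((((h.BB h).rlap.rpd j).cmul (1 / 2)).add ((((h.BB h).mul (h.BB h)).rpd j).cmul (-(lam / 2))))

theorem JJ_QQ (h : KK φ) {g : Ed d × Ed d → ℝ} (hg : PG g) (j : Fin d) (t : ℝ) :
    JJ g (QQ lam φ j t) (BB (φ t) (φ t)) =
      2 * (∑ k, JJ (pdx k g) (BB (pd j (φ t)) (pd k (φ t))) (BB (φ t) (φ t)))
      + (-(1 / 2) * JJ (pdx j g) (rlap (BB (φ t) (φ t))) (BB (φ t) (φ t))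
        + (lam / 2) * JJ (pdx j g) (fun w => BB (φ t) (φ t) w * BB (φ t) (φ t) w)
          (BB (φ t) (φ t))) := by
  have hr := h.BB h
  have hR := fun k => (h.pd j).BB (h.pd k)
  have k1 := fun k => (hR k).rpd k
  have k2 := hr.rlap.rpd j
  have k3 := (hr.mul hr).rpd j
  have e1 := JJ_add_F hg ((KK.sum Finset.univ k1).cmul (-2))
    ((k2.cmul (1 / 2)).add (k3.cmul (-(lam / 2)))) hr t
  have e2 := JJ_add_F hg (k2.cmul (1 / 2)) (k3.cmul (-(lam / 2))) hr t
  have e3 := JJ_sum_F Finset.univ hg k1 hr t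
  have i1 := fun k => ibp_x hg (hR k) hr t k
  have i2 := ibp_x hg hr.rlap hr t j
  have i3 := ibp_x hg (hr.mul hr) hr t j
  rw [JJ_cmul_F] at e1
  rw [JJ_cmul_F, JJ_cmul_F] at e2
  have e0 : JJ g (QQ lam φ j t) (BB (φ t) (φ t)) = _ := e1
  rw [e0, e2, e3]
  have e4 : ∑ k, JJ g (fun x => rpd k (BB (pd j (φ t)) (pd k (φ t))) x) (BB (φ t) (φ t))
      = - ∑ k, JJ (pdx k g) (BB (pd j (φ t)) (pd k (φ t))) (BB (φ t) (φ t)) := by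
    rw [← Finset.sum_neg_distrib]
    exact Finset.sum_congr rfl fun k _ => i1 k
  have e5 : JJ g (fun x => rpd j (rlap (BB (φ t) (φ t))) x) (BB (φ t) (φ t)) = _ := i2
  have e6 : JJ g (fun x => rpd j (fun w => BB (φ t) (φ t) w * BB (φ t) (φ t) w) x)
    (BB (φ t) (φ t)) = _ := i3
  rw [e4, e5, e6]
  ring

theorem JJ_dP (h : KK φ) {g : Ed d × Ed d → ℝ} (hg : PG g) (j : Fin d) (t : ℝ) :
    JJ g (Pphi φ j t) (fun x => ∑ l, (-2) * rpd l (Pphi φ l t) x) =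
      2 * ∑ l, JJ (pdy l g) (Pphi φ j t) (Pphi φ l t) := by
  have e := JJ_sum_H Finset.univ hg (h.P j) (fun l => ((h.P l).rpd l).cmul (-2)) t
  rw [e, Finset.mul_sum]
  refine Finset.sum_congr rfl fun l _ => ?_
  have i := ibp_y hg (h.P j) (h.P l) t l
  have i' : JJ g (Pphi φ j t) (fun x => rpd l (Pphi φ l t) x) = _ := i
  rw [JJ_cmul_H, i']
  ring

end helpers

/-- Interaction Morawetz identity for factorized solutions /
the cubic NLS. -/
theorem statement_16 (d : ℕ) (hd : 1 ≤ d) (lam : ℝ)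
    (φ : ℝ → Ed d → ℂ) (hφ : CubicNLSSolution d lam φ)
    (a : Ed d × Ed d → ℝ) (ha : ContDiff ℝ (⊤ : ℕ∞) a)
    (hpoly : ∀ k : ℕ, ∃ C : ℝ, ∃ m : ℕ, ∀ q : Ed d × Ed d,
        ‖iteratedFDeriv ℝ k a q‖ ≤ C * (1 + ‖q‖) ^ m)
    (t : ℝ) :
    deriv (fun s => ∫ x : Ed d, ∫ y : Ed d,
        ‖φ s y‖ ^ 2 * ∑ j, pdx j a (x, y) * Pphi φ j s x) t
      = -(1 / 2) * (∫ x : Ed d, ∫ y : Ed d,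
            ‖φ t y‖ ^ 2 * lapX a (x, y) * rlap (fun w => ‖φ t w‖ ^ 2) x)
        + (lam / 2) * (∫ x : Ed d, ∫ y : Ed d,
            lapX a (x, y) * (‖φ t y‖ ^ 2 * ‖φ t x‖ ^ 4))
        + 2 * (∫ x : Ed d, ∫ y : Ed d, ‖φ t y‖ ^ 2 * ∑ j, ∑ ℓ,
            pdx j (pdx ℓ a) (x, y) *
              (pd ℓ (φ t) x * starRingEnd ℂ (pd j (φ t) x)).re)
        + 2 * (∫ x : Ed d, ∫ y : Ed d, ∑ j, ∑ ℓ,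
            pdx j (pdy ℓ a) (x, y) * Pphi φ j t x * Pphi φ ℓ t y) := by
  have h := toKK hφ
  have hr := h.BB h
  have hg : PG a := ⟨ha, hpoly⟩
  have rho : ∀ s x, ‖φ s x‖ ^ 2 = BB (φ s) (φ s) x := fun s x => nsq _
  have hN : KK (fun s x => ∑ l, (-2) * rpd l (Pphi φ l s) x) :=
    KK.sum _ fun l => ((h.P l).rpd l).cmul (-2)
  have L : (fun s => ∫ x : Ed d, ∫ y : Ed d,
        ‖φ s y‖ ^ 2 * ∑ j, pdx j a (x, y) * Pphi φ j s x)
      = fun s => ∑ j, JJ (pdx j a) (Pphi φ j s) (BB (φ s) (φ s)) := by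
    ext s
    refine iter_sum (fun j => hg.pdx j) (fun j => h.P j) (fun _ => hr) s _ fun x y => ?_
    rw [rho, Finset.mul_sum]
    exact Finset.sum_congr rfl fun j _ => by ring
  have D : HasDerivAt (fun s => ∑ j, JJ (pdx j a) (Pphi φ j s) (BB (φ s) (φ s)))
      (∑ j, (JJ (pdx j a) (QQ lam φ j t) (BB (φ t) (φ t))
        + JJ (pdx j a) (Pphi φ j t) (fun x => ∑ l, (-2) * rpd l (Pphi φ l t) x))) t :=
    HasDerivAt.fun_sum fun j _ => JJ_hasDerivAt (hg.pdx j) (h.P j) hr (h.QQ j) hN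
      (hasDeriv_P hφ j) (hasDeriv_rho hφ) t
  have R1 : (∫ x : Ed d, ∫ y : Ed d,
            ‖φ t y‖ ^ 2 * lapX a (x, y) * rlap (fun w => ‖φ t w‖ ^ 2) x)
      = ∑ j, JJ (pdx j (pdx j a)) (rlap (BB (φ t) (φ t))) (BB (φ t) (φ t)) := by
    refine iter_sum (fun j => (hg.pdx j).pdx j) (fun _ => hr.rlap) (fun _ => hr) t _ fun x y => ?_
    have : (fun w => ‖φ t w‖ ^ 2) = BB (φ t) (φ t) := funext fun w => rho t w
    rw [this, rho, lapX, Finset.mul_sum, Finset.sum_mul]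
    exact Finset.sum_congr rfl fun j _ => by ring
  have R2 : (∫ x : Ed d, ∫ y : Ed d,
            lapX a (x, y) * (‖φ t y‖ ^ 2 * ‖φ t x‖ ^ 4))
      = ∑ j, JJ (pdx j (pdx j a)) (fun w => BB (φ t) (φ t) w * BB (φ t) (φ t) w)
          (BB (φ t) (φ t)) := by
    refine iter_sum (fun j => (hg.pdx j).pdx j) (fun _ => hr.mul hr) (fun _ => hr) t _
      fun x y => ?_
    have : ‖φ t x‖ ^ 4 = (‖φ t x‖ ^ 2) * (‖φ t x‖ ^ 2) := by ring
    rw [this, rho, rho, lapX, Finset.sum_mul]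
    exact Finset.sum_congr rfl fun j _ => by ring
  have R3 : (∫ x : Ed d, ∫ y : Ed d, ‖φ t y‖ ^ 2 * ∑ j, ∑ ℓ,
            pdx j (pdx ℓ a) (x, y) *
              (pd ℓ (φ t) x * starRingEnd ℂ (pd j (φ t) x)).re)
      = ∑ p : Fin d × Fin d, JJ (pdx p.1 (pdx p.2 a)) (BB (pd p.2 (φ t)) (pd p.1 (φ t)))
          (BB (φ t) (φ t)) := by
    refine iter_sum (fun p : Fin d × Fin d => (hg.pdx p.2).pdx p.1)
      (fun p => (h.pd p.2).BB (h.pd p.1)) (fun _ => hr) t _ fun x y => ?_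
    rw [rho, ← Fintype.sum_prod_type' (fun j ℓ => pdx j (pdx ℓ a) (x, y) *
              (pd ℓ (φ t) x * starRingEnd ℂ (pd j (φ t) x)).re), Finset.mul_sum]
    exact Finset.sum_congr rfl fun j _ => by unfold BB; ring
  have R4 : (∫ x : Ed d, ∫ y : Ed d, ∑ j, ∑ ℓ,
            pdx j (pdy ℓ a) (x, y) * Pphi φ j t x * Pphi φ ℓ t y)
      = ∑ p : Fin d × Fin d, JJ (pdx p.1 (pdy p.2 a)) (Pphi φ p.1 t) (Pphi φ p.2 t) := by
    refine iter_sum (fun p : Fin d × Fin d => (hg.pdy p.2).pdx p.1)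
      (fun p => h.P p.1) (fun p => h.P p.2) t _ fun x y => ?_
    rw [← Fintype.sum_prod_type' (fun j ℓ => pdx j (pdy ℓ a) (x, y) * Pphi φ j t x * Pphi φ ℓ t y)]
    exact Finset.sum_congr rfl fun j _ => by ring
  rw [L, D.deriv, R1, R2, R3, R4, Fintype.sum_prod_type_right, Fintype.sum_prod_type]
  simp only [Finset.mul_sum]
  rw [← Finset.sum_add_distrib, ← Finset.sum_add_distrib, ← Finset.sum_add_distrib]
  refine Finset.sum_congr rfl fun j _ => ?_
  rw [JJ_QQ h (hg.pdx j), JJ_dP h (hg.pdx j)]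
  simp only [pdx_pdy hg, Finset.mul_sum]
  ring
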